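/- Assume (A0) and (A1) with exponents $\Gamma\in[1,2)$, $\sigma\in(0,1]$. Let $(a,\rho)$ be the solution of the Friedmann system with initial data $a(0)=a_0>0$, $a'(0)=\dot a_0>0$, $\rho(0)=\rho_0>0$ satisfying $4\pi G(\rho_0+3P(\rho_0)/c^2)\ge c^2\Lambda$, on its maximal interval $]t_-,t_+[$ in $\{a>0,\rho>0\}$ (so that $t_-$ is finite, $a\to 0$ and $\rho\to+\infty$ as $t\to t_-+0$). Then $\rho(t)\,(t-t_-)^2\to \dfrac{1}{6\pi\Gamma^2 G}$ and $a(t)\,(t-t_-)^{-2/(3\Gamma)}\to (6\pi\Gamma^2 G\rho_1)^{1/(3\Gamma)}$ as $t\to t_-+0$, where $\rho_1=\lim_{t\to t_-+0}a(t)^{3\Gamma}\rho(t)>0$. -/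

import Mathlib

open Real Filter Set Topology Asymptotics

/-- Assumption (A0): `P` is a smooth function of `ρ > 0` with `0 ≤ P`,
`0 ≤ dP/dρ < c²` for `ρ > 0`, and `P → 0` as `ρ → 0⁺`. -/
def A0 (c : ℝ) (P : ℝ → ℝ) : Prop :=
  ContDiffOn ℝ (⊤ : ℕ∞) P (Set.Ioi 0) ∧
  (∀ ρ > (0 : ℝ), 0 ≤ P ρ) ∧
  (∀ ρ > (0 : ℝ), 0 ≤ deriv P ρ ∧ deriv P ρ < c ^ 2) ∧
  Filter.Tendsto P (nhdsWithin 0 (Set.Ioi 0)) (nhds 0)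

/-- A solution of the Friedmann system on a set `I`: `a > 0`, `ρ > 0`,
`a'' = (-(4πG/3)(ρ + 3P(ρ)/c²) + c²Λ/3) a` and `ρ' = -3(ρ + P(ρ)/c²) a'/a`. -/
def IsFriedmannSolution (c G Λ : ℝ) (P : ℝ → ℝ) (a ρ : ℝ → ℝ) (I : Set ℝ) : Prop :=
  ∀ t ∈ I, 0 < a t ∧ 0 < ρ t ∧
    DifferentiableAt ℝ a t ∧
    HasDerivAt (deriv a)
      ((-(4 * Real.pi * G / 3) * (ρ t + 3 * P (ρ t) / c ^ 2) + c ^ 2 * Λ / 3) * a t) t ∧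
    HasDerivAt ρ (-3 * (ρ t + P (ρ t) / c ^ 2) * (deriv a t / a t)) t

/-- `(a, ρ)` is a solution of the Friedmann system on the maximal interval of existence
`]t₋, t₊[` (with `-∞ ≤ t₋ < 0 < t₊ ≤ +∞`) in the domain `{a > 0, ρ > 0}`: the solution
property holds on `]t₋, t₊[`, and any solution with the same initial data at `t = 0`
is defined on a subinterval of `]t₋, t₊[`. -/
def IsMaximalSolution (c G Λ : ℝ) (P : ℝ → ℝ) (a ρ : ℝ → ℝ) (tm tp : EReal) : Prop :=
  tm < (0 : EReal) ∧ (0 : EReal) < tp ∧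
  IsFriedmannSolution c G Λ P a ρ {t : ℝ | tm < (t : EReal) ∧ (t : EReal) < tp} ∧
  ∀ (b σ : ℝ → ℝ) (s u : ℝ), s < 0 → 0 < u →
    IsFriedmannSolution c G Λ P b σ (Set.Ioo s u) →
    b 0 = a 0 → deriv b 0 = deriv a 0 → σ 0 = ρ 0 →
    tm ≤ (s : EReal) ∧ (u : EReal) ≤ tp

/-- Assumption (A1): there are `1 ≤ Γ < 2` and `0 < σ ≤ 1` such that
`P(ρ) = (Γ-1) c² ρ (1 + O(ρ^{-σ}))` as `ρ → +∞`. -/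
def A1 (c : ℝ) (P : ℝ → ℝ) (Γ σ : ℝ) : Prop :=
  1 ≤ Γ ∧ Γ < 2 ∧ 0 < σ ∧ σ ≤ 1 ∧
  ∃ E : ℝ → ℝ, (∀ᶠ ρ in Filter.atTop, P ρ = (Γ - 1) * c ^ 2 * ρ * (1 + E ρ)) ∧
    E =O[Filter.atTop] fun ρ : ℝ => ρ ^ (-σ)

theorem A0.monotoneOn {c : ℝ} {P : ℝ → ℝ} (h : A0 c P) : MonotoneOn P (Ioi 0) := by
  have hd : DifferentiableOn ℝ P (Ioi 0) := h.1.differentiableOn (by simp)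
  apply monotoneOn_of_deriv_nonneg (convex_Ioi 0) hd.continuousOn
  · simpa using hd
  · intro x hx
    rw [interior_Ioi] at hx
    exact (h.2.2.1 x hx).1

theorem A0.le_mul {c : ℝ} {P : ℝ → ℝ} (h : A0 c P) {x : ℝ} (hx : 0 < x) :
    P x ≤ c ^ 2 * x := by
  have hd : DifferentiableOn ℝ P (Ioi 0) := h.1.differentiableOn (by simp)
  have hmono : MonotoneOn (fun y => c ^ 2 * y - P y) (Ioi 0) := by
    have hd' : DifferentiableOn ℝ (fun y => c ^ 2 * y - P y) (Ioi 0) := by fun_prop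
    apply monotoneOn_of_deriv_nonneg (convex_Ioi 0) hd'.continuousOn
    · simpa using hd'
    · intro y hy
      rw [interior_Ioi] at hy
      have hPy := (hd.differentiableAt (Ioi_mem_nhds hy)).hasDerivAt
      rw [(((hasDerivAt_id' y).const_mul (c ^ 2)).fun_sub hPy).deriv]
      linarith [(h.2.2.1 y hy).2]
  have hlim : Tendsto (fun y => c ^ 2 * y - P y) (𝓝[>] 0) (𝓝 0) := by
    have h1 : Tendsto (fun y : ℝ => c ^ 2 * y) (𝓝[>] 0) (𝓝 (c ^ 2 * 0)) :=
      (continuous_const.mul continuous_id).continuousAt.mono_left nhdsWithin_le_nhds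
    simpa using h1.sub h.2.2.2
  have hle : 0 ≤ c ^ 2 * x - P x := by
    refine le_of_tendsto hlim ?_
    filter_upwards [Ioo_mem_nhdsGT hx] with y hy
    exact hmono hy.1 hx hy.2.le
  linarith

/-- A solution of an autonomous equation that converges, at the left end of its interval, to a point
where the vector field is `C¹` can be continued to the left. -/
theorem exists_hasDerivAt_extend_left {E : Type*} [NormedAddCommGroup E] [NormedSpace ℝ E]
    [CompleteSpace E] {F : E → E} {x₀ : E} (hF : ContDiffAt ℝ 1 F x₀) {T u : ℝ} (hTu : T < u)
    {X : ℝ → E} (hX : ∀ t ∈ Ioo T u, HasDerivAt X (F (X t)) t)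
    (hlim : Tendsto X (𝓝[>] T) (𝓝 x₀)) {U : Set E} (hU : U ∈ 𝓝 x₀) :
    ∃ ε > 0, ∃ Z : ℝ → E, (∀ t ∈ Ioo (T - ε) u, HasDerivAt Z (F (Z t)) t) ∧
      (∀ t > T, Z t = X t) ∧ ∀ t ∈ Ioc (T - ε) T, Z t ∈ U := by
  obtain ⟨Y, hY0, ε₁, hε₁, hY⟩ :=
    hF.exists_forall_mem_closedBall_exists_eq_forall_mem_Ioo_hasDerivAt₀ T
  have hYT : HasDerivAt Y (F x₀) T := by
    simpa [hY0] using hY T ⟨by linarith, by linarith⟩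
  have hYU : ∀ᶠ t in 𝓝 T, Y t ∈ U := by
    apply hYT.continuousAt
    rwa [hY0]
  obtain ⟨ε₂, hε₂, hU'⟩ := Metric.eventually_nhds_iff.1 hYU
  set Z : ℝ → E := fun t => if t ≤ T then Y t else X t with hZ
  have hZle : ∀ t ≤ T, Z t = Y t := fun t ht => if_pos ht
  have hZgt : ∀ t > T, Z t = X t := fun t ht => if_neg (not_le.2 ht)
  refine ⟨min ε₁ ε₂, lt_min hε₁ hε₂, Z, ?_, hZgt, ?_⟩
  · rintro t ⟨ht1, ht2⟩
    rcases lt_trichotomy t T with ht | rfl | ht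
    · have hev : Z =ᶠ[𝓝 t] Y := by
        filter_upwards [Iio_mem_nhds ht] with s hs using hZle s (le_of_lt hs)
      rw [hZle t ht.le]
      exact (hY t ⟨by linarith [min_le_left ε₁ ε₂], by linarith⟩).congr_of_eventuallyEq hev
    · rw [hZle t le_rfl, hY0]
      have hleft : HasDerivWithinAt Z (F x₀) (Iic t) t :=
        hYT.hasDerivWithinAt.congr (fun s hs => hZle s hs) (hZle t le_rfl)
      have hdiff : DifferentiableOn ℝ Z (Ioo t u) := fun s hs =>
        ((hX s hs).differentiableAt.congr_of_eventuallyEq (by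
          filter_upwards [Ioi_mem_nhds hs.1] with r hr using hZgt r hr)).differentiableWithinAt
      have hZlim : Tendsto Z (𝓝[>] t) (𝓝 x₀) := hlim.congr' (by
        filter_upwards [self_mem_nhdsWithin] with s hs using (hZgt s hs).symm)
      have hright : HasDerivWithinAt Z (F x₀) (Ici t) t := by
        apply hasDerivWithinAt_Ici_of_tendsto_deriv hdiff
        · have : Tendsto Z (𝓝[Ioo t u] t) (𝓝 (Z t)) := by
            rw [hZle t le_rfl, hY0]
            exact hZlim.mono_left (nhdsWithin_mono _ Ioo_subset_Ioi_self)
          exact this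
        · exact Ioo_mem_nhdsGT ht2
        · refine (hF.continuousAt.tendsto.comp hlim).congr' ?_
          filter_upwards [Ioo_mem_nhdsGT ht2] with s hs
          have hev : Z =ᶠ[𝓝 s] X := by
            filter_upwards [Ioi_mem_nhds hs.1] with r hr using hZgt r hr
          rw [hev.deriv_eq, (hX s hs).deriv, Function.comp]
      simpa [Iic_union_Ici] using hleft.union hright
    · have hev : Z =ᶠ[𝓝 t] X := by
        filter_upwards [Ioi_mem_nhds ht] with s hs using hZgt s hs
      rw [hZgt t ht]
      exact (hX t ⟨ht, ht2⟩).congr_of_eventuallyEq hev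
  · rintro t ⟨ht1, ht2⟩
    rw [hZle t ht2]
    apply hU'
    rw [Real.dist_eq, abs_lt]
    constructor <;> linarith [min_le_right ε₁ ε₂]

theorem monotoneOn_Ioo_of_hasDerivAt {f f' : ℝ → ℝ} {T u : ℝ}
    (hf : ∀ t ∈ Ioo T u, HasDerivAt f (f' t) t) (hf' : ∀ t ∈ Ioo T u, 0 ≤ f' t) :
    MonotoneOn f (Ioo T u) := by
  apply monotoneOn_of_deriv_nonneg (convex_Ioo T u)
  · exact fun t ht => (hf t ht).continuousAt.continuousWithinAt
  · rw [interior_Ioo]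
    exact fun t ht => (hf t ht).differentiableAt.differentiableWithinAt
  · rw [interior_Ioo]
    intro t ht
    rw [(hf t ht).deriv]
    exact hf' t ht

theorem antitoneOn_Ioo_of_hasDerivAt {f f' : ℝ → ℝ} {T u : ℝ}
    (hf : ∀ t ∈ Ioo T u, HasDerivAt f (f' t) t) (hf' : ∀ t ∈ Ioo T u, f' t ≤ 0) :
    AntitoneOn f (Ioo T u) := by
  apply antitoneOn_of_deriv_nonpos (convex_Ioo T u)
  · exact fun t ht => (hf t ht).continuousAt.continuousWithinAt
  · rw [interior_Ioo]
    exact fun t ht => (hf t ht).differentiableAt.differentiableWithinAt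
  · rw [interior_Ioo]
    intro t ht
    rw [(hf t ht).deriv]
    exact hf' t ht

/-- A function whose derivative is dominated by that of a function with a limit has a limit. -/
theorem exists_tendsto_nhdsGT_of_abs_deriv_le {f f' g g' : ℝ → ℝ} {T u m : ℝ} (hTu : T < u)
    (hf : ∀ t ∈ Ioo T u, HasDerivAt f (f' t) t) (hg : ∀ t ∈ Ioo T u, HasDerivAt g (g' t) t)
    (hle : ∀ t ∈ Ioo T u, |f' t| ≤ g' t) (hm : Tendsto g (𝓝[>] T) (𝓝 m)) :
    ∃ l, Tendsto f (𝓝[>] T) (𝓝 l) := by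
  have hadd : MonotoneOn (fun t => f t + g t) (Ioo T u) :=
    monotoneOn_Ioo_of_hasDerivAt (fun t ht => (hf t ht).fun_add (hg t ht)) fun t ht => by
      linarith [neg_abs_le (f' t), hle t ht]
  have hsub : AntitoneOn (fun t => f t - g t) (Ioo T u) :=
    antitoneOn_Ioo_of_hasDerivAt (fun t ht => (hf t ht).fun_sub (hg t ht)) fun t ht => by
      linarith [le_abs_self (f' t), hle t ht]
  have hgmono : MonotoneOn g (Ioo T u) :=
    monotoneOn_Ioo_of_hasDerivAt hg fun t ht => (abs_nonneg _).trans (hle t ht)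
  have hgm : ∀ t ∈ Ioo T u, m ≤ g t := fun t ht => by
    refine le_of_tendsto hm ?_
    filter_upwards [Ioo_mem_nhdsGT ht.1] with s hs
    exact hgmono ⟨hs.1, hs.2.trans ht.2⟩ ht hs.2.le
  obtain ⟨p, hp⟩ : (Ioo T u).Nonempty := nonempty_Ioo.2 hTu
  have hbdd : BddBelow ((fun t => f t + g t) '' Ioo T p) := by
    refine ⟨f p - g p + 2 * m, ?_⟩
    rintro _ ⟨t, ht, rfl⟩
    have ht' : t ∈ Ioo T u := ⟨ht.1, ht.2.trans hp.2⟩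
    have h1 : f p - g p ≤ f t - g t := hsub ht' hp ht.2.le
    have h2 := hgm t ht'
    simp only
    linarith
  have hlim := (hadd.mono (Ioo_subset_Ioo_right hp.2.le)).tendsto_nhdsWithin_Ioo_right
    (nonempty_Ioo.2 hp.1) hbdd
  exact ⟨_, (hlim.sub hm).congr fun t => by ring⟩

/-- While `a` is increasing, going back in time raises `ρ` and keeps `a` concave. -/
theorem IsFriedmannSolution.antitoneOn {c G Λ : ℝ} {P a ρ : ℝ → ℝ} {s : ℝ} (hG : 0 < G)
    (hA0 : A0 c P) (hs : s ≤ 0) (h : IsFriedmannSolution c G Λ P a ρ (Icc s 0))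
    (hcond : c ^ 2 * Λ ≤ 4 * π * G * (ρ 0 + 3 * P (ρ 0) / c ^ 2))
    (hpos : ∀ t ∈ Ioc s 0, 0 < deriv a t) :
    AntitoneOn ρ (Icc s 0) ∧ AntitoneOn (deriv a) (Icc s 0) := by
  have hρ : AntitoneOn ρ (Icc s 0) := by
    apply antitoneOn_of_deriv_nonpos (convex_Icc s 0)
    · exact fun t ht => (h t ht).2.2.2.2.continuousAt.continuousWithinAt
    · exact fun t ht =>
        (h t (interior_subset ht)).2.2.2.2.differentiableAt.differentiableWithinAt
    · intro t ht
      obtain ⟨ha, hr, -, -, hd⟩ := h t (interior_subset ht)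
      rw [interior_Icc] at ht
      rw [hd.deriv]
      have h1 := hpos t ⟨ht.1, ht.2.le⟩
      have h2 := hA0.2.1 _ hr
      have h3 : 0 ≤ (ρ t + P (ρ t) / c ^ 2) * (deriv a t / a t) := by positivity
      linarith
  refine ⟨hρ, ?_⟩
  apply antitoneOn_of_deriv_nonpos (convex_Icc s 0)
  · exact fun t ht => (h t ht).2.2.2.1.continuousAt.continuousWithinAt
  · exact fun t ht =>
      (h t (interior_subset ht)).2.2.2.1.differentiableAt.differentiableWithinAt
  · intro t ht
    have ht' : t ∈ Icc s 0 := interior_subset ht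
    obtain ⟨ha, hr, -, hd, -⟩ := h t ht'
    rw [hd.deriv]
    have h0 : (0 : ℝ) ∈ Icc s 0 := ⟨hs, le_rfl⟩
    have h1 : ρ 0 ≤ ρ t := hρ ht' h0 ht'.2
    have h2 : P (ρ 0) ≤ P (ρ t) := hA0.monotoneOn (h 0 h0).2.1 hr h1
    have h3 : ρ 0 + 3 * P (ρ 0) / c ^ 2 ≤ ρ t + 3 * P (ρ t) / c ^ 2 := by gcongr
    have h4 : 4 * π * G * (ρ 0 + 3 * P (ρ 0) / c ^ 2) ≤
        4 * π * G * (ρ t + 3 * P (ρ t) / c ^ 2) := by gcongr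
    apply mul_nonpos_of_nonpos_of_nonneg _ ha.le
    linarith

theorem IsFriedmannSolution.mono {c G Λ : ℝ} {P a ρ : ℝ → ℝ} {I J : Set ℝ}
    (h : IsFriedmannSolution c G Λ P a ρ I) (hJ : J ⊆ I) : IsFriedmannSolution c G Λ P a ρ J :=
  fun t ht => h t (hJ ht)

theorem IsFriedmannSolution.deriv_pos {c G Λ : ℝ} {P a ρ : ℝ → ℝ} {s : ℝ} (hG : 0 < G)
    (hA0 : A0 c P) (h : IsFriedmannSolution c G Λ P a ρ (Icc s 0))
    (hcond : c ^ 2 * Λ ≤ 4 * π * G * (ρ 0 + 3 * P (ρ 0) / c ^ 2)) (h0 : 0 < deriv a 0) :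
    ∀ t ∈ Icc s 0, 0 < deriv a t := by
  by_contra! hne
  have hcont : ContinuousOn (deriv a) (Icc s 0) := fun t ht =>
    (h t ht).2.2.2.1.continuousAt.continuousWithinAt
  have hcpt : IsCompact (Icc s 0 ∩ deriv a ⁻¹' Iic 0) :=
    isCompact_Icc.of_isClosed_subset (hcont.preimage_isClosed_of_isClosed isClosed_Icc isClosed_Iic)
      inter_subset_left
  obtain ⟨t, ht, htmax⟩ := hcpt.exists_isGreatest (by
    obtain ⟨t, ht, ht'⟩ := hne
    exact ⟨t, ht, ht'⟩)
  obtain ⟨hts, ht0⟩ := ht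
  have hanti := ((h.mono (Icc_subset_Icc_left hts.1)).antitoneOn hG hA0 hts.2 hcond
    (fun r hr => by
      by_contra! hr'
      exact absurd (htmax ⟨⟨hts.1.trans hr.1.le, hr.2⟩, hr'⟩) (not_le.2 hr.1))).2
  have := hanti ⟨le_rfl, hts.2⟩ ⟨hts.2, le_rfl⟩ hts.2
  exact absurd (h0.trans_le this) (not_lt.2 ht0)

theorem IsFriedmannSolution.le_add_mul {c G Λ : ℝ} {P a ρ : ℝ → ℝ} {s : ℝ} (hG : 0 < G)
    (hA0 : A0 c P) (hs : s ≤ 0) (h : IsFriedmannSolution c G Λ P a ρ (Icc s 0))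
    (hcond : c ^ 2 * Λ ≤ 4 * π * G * (ρ 0 + 3 * P (ρ 0) / c ^ 2)) (h0 : 0 < deriv a 0) :
    a s ≤ a 0 + deriv a 0 * s := by
  have hanti := (h.antitoneOn hG hA0 hs hcond fun t ht =>
    h.deriv_pos hG hA0 hcond h0 t (Ioc_subset_Icc_self ht)).2
  have := (convex_Icc s 0).mul_sub_le_image_sub_of_le_deriv (f := a) (C := deriv a 0)
    (fun t ht => (h t ht).2.2.1.continuousAt.continuousWithinAt)
    (fun t ht => (h t (interior_subset ht)).2.2.1.differentiableWithinAt)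
    (fun t ht => hanti (interior_subset ht) ⟨hs, le_rfl⟩ (interior_subset ht).2)
    s ⟨le_rfl, hs⟩ 0 ⟨hs, le_rfl⟩ hs
  linarith

/-- The Friedmann first integral. -/
theorem IsFriedmannSolution.exists_sq_deriv_eq {c G Λ : ℝ} {P a ρ : ℝ → ℝ} {T u : ℝ}
    (hTu : T < u) (h : IsFriedmannSolution c G Λ P a ρ (Ioo T u)) :
    ∃ k, ∀ t ∈ Ioo T u,
      deriv a t ^ 2 = 8 * π * G / 3 * (ρ t * a t ^ 2) + c ^ 2 * Λ / 3 * a t ^ 2 - k := by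
  set f : ℝ → ℝ := fun t =>
    8 * π * G / 3 * (ρ t * a t ^ 2) + c ^ 2 * Λ / 3 * a t ^ 2 - deriv a t ^ 2 with hf
  have hd : ∀ t ∈ Ioo T u, HasDerivAt f 0 t := fun t ht => by
    obtain ⟨ha, -, hda, hdda, hdr⟩ := h t ht
    have ha2 := hda.hasDerivAt.fun_pow 2
    convert! (((hdr.fun_mul ha2).const_mul (8 * π * G / 3)).fun_add
      (ha2.const_mul (c ^ 2 * Λ / 3))).fun_sub (hdda.fun_pow 2) using 1
    field_simp
    ring
  obtain ⟨p, hp⟩ := nonempty_Ioo.2 hTu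
  have hmono := monotoneOn_Ioo_of_hasDerivAt hd fun _ _ => le_rfl
  have hanti := antitoneOn_Ioo_of_hasDerivAt hd fun _ _ => le_rfl
  refine ⟨f p, fun t ht => ?_⟩
  have : f t = f p := by
    rcases le_total t p with htp | htp
    · exact le_antisymm (hmono ht hp htp) (hanti ht hp htp)
    · exact le_antisymm (hanti hp ht htp) (hmono hp ht htp)
  simp only [hf] at this ⊢
  linarith

theorem IsFriedmannSolution.antitoneOn_mul_pow {c G Λ : ℝ} {P a ρ : ℝ → ℝ} {T u : ℝ}
    (hA0 : A0 c P) (h : IsFriedmannSolution c G Λ P a ρ (Ioo T u))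
    (hpos : ∀ t ∈ Ioo T u, 0 < deriv a t) : AntitoneOn (fun t => ρ t * a t ^ 3) (Ioo T u) := by
  apply antitoneOn_Ioo_of_hasDerivAt
    (fun t ht => (h t ht).2.2.2.2.fun_mul ((h t ht).2.2.1.hasDerivAt.fun_pow 3))
  intro t ht
  obtain ⟨ha, hr, -, -, -⟩ := h t ht
  have h1 := hpos t ht
  have h2 := hA0.2.1 _ hr
  have h3 : 0 ≤ 3 * (P (ρ t) / c ^ 2) * deriv a t * a t ^ 2 := by positivity
  calc _ = -(3 * (P (ρ t) / c ^ 2) * deriv a t * a t ^ 2) := by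
        generalize P (ρ t) / c ^ 2 = q
        field_simp
        push_cast
        ring
    _ ≤ 0 := by linarith

theorem IsFriedmannSolution.monotoneOn_mul_pow {c G Λ : ℝ} {P a ρ : ℝ → ℝ} {T u : ℝ} (hc : 0 < c)
    (hA0 : A0 c P) (h : IsFriedmannSolution c G Λ P a ρ (Ioo T u))
    (hpos : ∀ t ∈ Ioo T u, 0 < deriv a t) : MonotoneOn (fun t => ρ t * a t ^ 6) (Ioo T u) := by
  apply monotoneOn_Ioo_of_hasDerivAt
    (fun t ht => (h t ht).2.2.2.2.fun_mul ((h t ht).2.2.1.hasDerivAt.fun_pow 6))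
  intro t ht
  obtain ⟨ha, hr, -, -, -⟩ := h t ht
  have h1 := hpos t ht
  have h2 : P (ρ t) / c ^ 2 ≤ ρ t := by
    rw [div_le_iff₀ (by positivity)]
    linarith [hA0.le_mul hr]
  have h3 : 0 ≤ ρ t - P (ρ t) / c ^ 2 := by linarith
  have h4 : 0 ≤ 3 * (ρ t - P (ρ t) / c ^ 2) * deriv a t * a t ^ 5 := by positivity
  refine h4.trans_eq ?_
  generalize P (ρ t) / c ^ 2 = q
  field_simp
  push_cast
  ring

/-- A solution whose data converge to a point of the domain at the left end of its interval
can be continued to the left. -/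
theorem IsFriedmannSolution.exists_extend_left {c G Λ : ℝ} {P a ρ : ℝ → ℝ} {T u A B R : ℝ}
    (hA0 : A0 c P) (hTu : T < u) (h : IsFriedmannSolution c G Λ P a ρ (Ioo T u))
    (hA : 0 < A) (hR : 0 < R) (ha : Tendsto a (𝓝[>] T) (𝓝 A))
    (ha' : Tendsto (deriv a) (𝓝[>] T) (𝓝 B)) (hρ : Tendsto ρ (𝓝[>] T) (𝓝 R)) :
    ∃ ε > 0, ∃ b r : ℝ → ℝ, IsFriedmannSolution c G Λ P b r (Ioo (T - ε) u) ∧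
      ∀ t ∈ Ioo T u, b t = a t ∧ deriv b t = deriv a t ∧ r t = ρ t := by
  set F : ℝ × ℝ × ℝ → ℝ × ℝ × ℝ := fun x =>
    (x.2.1, (-(4 * π * G / 3) * (x.2.2 + 3 * P x.2.2 / c ^ 2) + c ^ 2 * Λ / 3) * x.1,
      -3 * (x.2.2 + P x.2.2 / c ^ 2) * (x.2.1 / x.1)) with hF
  have hFc : ContDiffAt ℝ 1 F (A, B, R) := by
    have h1 : ContDiffAt ℝ 1 (fun x : ℝ × ℝ × ℝ => x.1) (A, B, R) := contDiffAt_fst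
    have h2 : ContDiffAt ℝ 1 (fun x : ℝ × ℝ × ℝ => x.2.1) (A, B, R) := by fun_prop
    have h3 : ContDiffAt ℝ 1 (fun x : ℝ × ℝ × ℝ => x.2.2) (A, B, R) := by fun_prop
    have hP : ContDiffAt ℝ 1 P R :=
      (hA0.1.contDiffAt (Ioi_mem_nhds hR)).of_le (by exact_mod_cast le_top)
    have h4 : ContDiffAt ℝ 1 (fun x : ℝ × ℝ × ℝ => P x.2.2) (A, B, R) :=
      hP.comp (A, B, R) h3
    refine h2.prodMk (ContDiffAt.prodMk ?_ ?_)
    · fun_prop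
    · exact (contDiffAt_const.mul (h3.add (h4.div_const _))).mul (h2.div h1 hA.ne')
  obtain ⟨ε, hε, Z, hZ, hZX, hZU⟩ := exists_hasDerivAt_extend_left hFc hTu
    (X := fun t => (a t, deriv a t, ρ t))
    (fun t ht => by
      obtain ⟨-, -, hda, hdda, hdr⟩ := h t ht
      exact hda.hasDerivAt.prodMk (hdda.prodMk hdr))
    (ha.prodMk_nhds (ha'.prodMk_nhds hρ))
    (U := {x : ℝ × ℝ × ℝ | 0 < x.1 ∧ 0 < x.2.2})
    ((continuous_fst.continuousAt.eventually (Ioi_mem_nhds hA)).and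
      ((continuous_snd.comp continuous_snd).continuousAt.eventually (Ioi_mem_nhds hR)))
  have hd1 : ∀ t ∈ Ioo (T - ε) u, HasDerivAt (fun s => (Z s).1) (Z t).2.1 t := fun t ht =>
    (hZ t ht).fst
  have hd2 : ∀ t ∈ Ioo (T - ε) u, deriv (fun s => (Z s).1) t = (Z t).2.1 := fun t ht =>
    (hd1 t ht).deriv
  refine ⟨ε, hε, fun t => (Z t).1, fun t => (Z t).2.2, fun t ht => ?_, fun t ht => ?_⟩
  · have hpos : 0 < (Z t).1 ∧ 0 < (Z t).2.2 := by
      rcases le_or_gt t T with htT | htT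
      · exact hZU t ⟨ht.1, htT⟩
      · rw [hZX t htT]
        exact ⟨(h t ⟨htT, ht.2⟩).1, (h t ⟨htT, ht.2⟩).2.1⟩
    refine ⟨hpos.1, hpos.2, (hd1 t ht).differentiableAt, ?_, ?_⟩
    · have hsnd : HasDerivAt (fun s => (Z s).2.1) (F (Z t)).2.1 t := (hZ t ht).snd.fst
      refine hsnd.congr_of_eventuallyEq ?_
      filter_upwards [Ioo_mem_nhds ht.1 ht.2] with s hs using hd2 s hs
    · rw [hd2 t ht]
      exact (hZ t ht).snd.snd
  · rw [hd2 t ⟨by linarith [ht.1], ht.2⟩]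
    simp only [hZX t ht.1, and_self]

/-- The scale factor vanishes at the left end of the maximal interval. -/
theorem IsMaximalSolution.tendsto_zero {c G Λ : ℝ} {P a ρ : ℝ → ℝ} {T : ℝ} {tp : EReal}
    (hc : 0 < c) (hG : 0 < G) (hA0 : A0 c P) (hmax : IsMaximalSolution c G Λ P a ρ T tp)
    (hcond : c ^ 2 * Λ ≤ 4 * π * G * (ρ 0 + 3 * P (ρ 0) / c ^ 2)) (h0 : 0 < deriv a 0) :
    Tendsto a (𝓝[>] T) (𝓝 0) := by
  obtain ⟨hT0, htp, hsol, hext⟩ := hmax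
  have hT : T < 0 := by exact_mod_cast hT0
  obtain ⟨u, hu0, hutp⟩ := EReal.lt_iff_exists_real_btwn.1 htp
  have hu : 0 < u := by exact_mod_cast hu0
  have h : IsFriedmannSolution c G Λ P a ρ (Ioo T u) := hsol.mono fun t ht =>
    ⟨by exact_mod_cast ht.1, lt_trans (by exact_mod_cast ht.2) hutp⟩
  have hIcc : ∀ s ∈ Ioo T 0, IsFriedmannSolution c G Λ P a ρ (Icc s 0) := fun s hs =>
    h.mono fun t ht => ⟨hs.1.trans_le ht.1, ht.2.trans_lt hu⟩
  have hsub : Ioo T 0 ⊆ Ioo T u := Ioo_subset_Ioo_right hu.le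
  have hpos : ∀ t ∈ Ioo T 0, 0 < deriv a t := fun t ht =>
    (hIcc t ht).deriv_pos hG hA0 hcond h0 t ⟨le_rfl, ht.2.le⟩
  have hanti : ∀ s ∈ Ioo T 0, AntitoneOn ρ (Icc s 0) ∧ AntitoneOn (deriv a) (Icc s 0) :=
    fun s hs => (hIcc s hs).antitoneOn hG hA0 hs.2.le hcond fun t ht =>
      (hIcc s hs).deriv_pos hG hA0 hcond h0 t (Ioc_subset_Icc_self ht)
  have hρ : AntitoneOn ρ (Ioo T 0) := fun s hs t ht hst =>
    (hanti s hs).1 ⟨le_rfl, hs.2.le⟩ ⟨hst, ht.2.le⟩ hst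
  have ha' : AntitoneOn (deriv a) (Ioo T 0) := fun s hs t ht hst =>
    (hanti s hs).2 ⟨le_rfl, hs.2.le⟩ ⟨hst, ht.2.le⟩ hst
  have hneg := h.mono hsub
  have ha : MonotoneOn a (Ioo T 0) := monotoneOn_Ioo_of_hasDerivAt
    (fun t ht => (hneg t ht).2.2.1.hasDerivAt) fun t ht => (hpos t ht).le
  obtain ⟨p, hp⟩ := nonempty_Ioo.2 hT
  have hlim := ha.tendsto_nhdsWithin_Ioo_right ⟨p, hp⟩
    ⟨0, by rintro _ ⟨t, ht, rfl⟩; exact (hneg t ht).1.le⟩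
  generalize sInf (a '' Ioo T 0) = A at hlim
  have hAle : ∀ t ∈ Ioo T 0, A ≤ a t := fun t ht => le_of_tendsto hlim (by
    filter_upwards [Ioo_mem_nhdsGT ht.1] with s hs
    exact ha ⟨hs.1, hs.2.trans ht.2⟩ ht hs.2.le)
  have hA0' : 0 ≤ A := ge_of_tendsto hlim (by
    filter_upwards [Ioo_mem_nhdsGT hT] with s hs using (hneg s hs).1.le)
  rcases hA0'.eq_or_lt with rfl | hA
  · exact hlim
  exfalso
  -- If the limit `A` were positive, `ρ` and `a'` would stay bounded and the solution would extend.
  have hρle : ∀ t ∈ Ioo T p, ρ t ≤ ρ p * a p ^ 6 / A ^ 6 := fun t ht => by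
    have ht' : t ∈ Ioo T 0 := ⟨ht.1, ht.2.trans hp.2⟩
    have h1 : ρ t * a t ^ 6 ≤ ρ p * a p ^ 6 :=
      hneg.monotoneOn_mul_pow hc hA0 hpos ht' hp ht.2.le
    have h2 : A ^ 6 ≤ a t ^ 6 := pow_le_pow_left₀ hA.le (hAle t ht') 6
    have h3 := (hneg t ht').2.1
    rw [le_div_iff₀ (by positivity)]
    exact (mul_le_mul_of_nonneg_left h2 h3.le).trans h1
  have hsubp : Ioo T p ⊆ Ioo T 0 := Ioo_subset_Ioo_right hp.2.le
  have hρlim := (hρ.mono hsubp).tendsto_nhdsWithin_Ioo_right (nonempty_Ioo.2 hp.1)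
    ⟨_, by rintro _ ⟨t, ht, rfl⟩; exact hρle t ht⟩
  generalize sSup (ρ '' Ioo T p) = R at hρlim
  have hR : 0 < R := (hneg p hp).2.1.trans_le (ge_of_tendsto hρlim (by
    filter_upwards [Ioo_mem_nhdsGT hp.1] with s hs
    exact hρ (hsubp hs) hp hs.2.le))
  obtain ⟨k, hk⟩ := hneg.exists_sq_deriv_eq hT
  have ha'lim : Tendsto (deriv a) (𝓝[>] T)
      (𝓝 (√(8 * π * G / 3 * (R * A ^ 2) + c ^ 2 * Λ / 3 * A ^ 2 - k))) := by
    refine (((((hρlim.mul (hlim.pow 2)).const_mul (8 * π * G / 3)).add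
      ((hlim.pow 2).const_mul (c ^ 2 * Λ / 3))).sub_const k).sqrt).congr' ?_
    filter_upwards [Ioo_mem_nhdsGT hT] with t ht
    rw [← hk t ht, Real.sqrt_sq (hpos t ht).le]
  obtain ⟨ε, hε, b, r, hbr, heq⟩ := h.exists_extend_left hA0 (hT.trans hu) hA hR hlim ha'lim hρlim
  have h00 := heq 0 ⟨hT, hu⟩
  have hle := (hext b r (T - ε) u (by linarith) hu hbr h00.1 h00.2.1 h00.2.2).1
  have : T ≤ T - ε := by exact_mod_cast hle
  linarith

theorem A1.exists_eventually_abs_le {c : ℝ} {P : ℝ → ℝ} {Γ σ : ℝ} (hc : 0 < c)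
    (h : A1 c P Γ σ) :
    ∃ C > 0, ∀ᶠ x in atTop, |(Γ - 1) - P x / c ^ 2 / x| ≤ C * x ^ (-σ) := by
  obtain ⟨hΓ1, hΓ2, -, -, E, hE, hO⟩ := h
  obtain ⟨C, hC, hb⟩ := hO.exists_pos
  refine ⟨C, hC, ?_⟩
  filter_upwards [hE, hb.bound, eventually_gt_atTop 0] with x hx hbx hx0
  have hxσ : 0 < x ^ (-σ) := rpow_pos_of_pos hx0 _
  rw [Real.norm_eq_abs, Real.norm_eq_abs, abs_of_pos hxσ] at hbx
  have heq : (Γ - 1) - P x / c ^ 2 / x = -((Γ - 1) * E x) := by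
    rw [hx]
    field_simp
    ring
  rw [heq, abs_neg, abs_mul, abs_of_nonneg (by linarith)]
  calc (Γ - 1) * |E x| ≤ 1 * |E x| := by gcongr; linarith
    _ ≤ _ := by linarith

/-- If `a → 0` with `a` increasing, then `a ^ (3Γ) ρ` has a positive limit. -/
theorem IsFriedmannSolution.exists_tendsto_rpow_mul {c G Λ : ℝ} {P a ρ : ℝ → ℝ} {T u Γ σ : ℝ}
    (hc : 0 < c) (hA0 : A0 c P) (hA1 : A1 c P Γ σ) (hTu : T < u)
    (h : IsFriedmannSolution c G Λ P a ρ (Ioo T u)) (hpos : ∀ t ∈ Ioo T u, 0 < deriv a t)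
    (ha : Tendsto a (𝓝[>] T) (𝓝 0)) :
    ∃ R > 0, Tendsto (fun t => a t ^ (3 * Γ) * ρ t) (𝓝[>] T) (𝓝 R) := by
  obtain ⟨p, hp⟩ := nonempty_Ioo.2 hTu
  set k := ρ p * a p ^ 3 with hk
  have hkpos : 0 < k := mul_pos (h p hp).2.1 (pow_pos (h p hp).1 3)
  have hkle : ∀ t ∈ Ioo T p, k / a t ^ 3 ≤ ρ t := fun t ht => by
    have ht' : t ∈ Ioo T u := ⟨ht.1, ht.2.trans hp.2⟩
    rw [div_le_iff₀ (pow_pos (h t ht').1 3)]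
    exact h.antitoneOn_mul_pow hA0 hpos ht' hp ht.2.le
  have ha3 : Tendsto (fun t => a t ^ 3) (𝓝[>] T) (𝓝[>] 0) := by
    refine tendsto_nhdsWithin_iff.2 ⟨by simpa using ha.pow 3, ?_⟩
    filter_upwards [Ioo_mem_nhdsGT hTu] with t ht using pow_pos (h t ht).1 3
  have hρ : Tendsto ρ (𝓝[>] T) atTop := by
    refine tendsto_atTop_mono' _ ?_ (ha3.inv_tendsto_nhdsGT_zero.const_mul_atTop hkpos)
    filter_upwards [Ioo_mem_nhdsGT hp.1] with t ht
    simpa [div_eq_mul_inv] using hkle t ht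
  have hσ : 0 < σ := hA1.2.2.1
  obtain ⟨C, hC, hPC⟩ := hA1.exists_eventually_abs_le hc
  obtain ⟨v, hv, hPv⟩ := mem_nhdsGT_iff_exists_Ioo_subset.1 (hρ.eventually hPC)
  have hTw : T < min v p := lt_min hv hp.1
  have hda : ∀ t ∈ Ioo T (min v p), HasDerivAt a (deriv a t) t := fun t ht =>
    (h t ⟨ht.1, (ht.2.trans_le (min_le_right _ _)).trans hp.2⟩).2.2.1.hasDerivAt
  have hsol := h.mono (Ioo_subset_Ioo_right ((min_le_right v p).trans hp.2.le))
  have ha3σ : Tendsto (fun t => C * k ^ (-σ) / σ * a t ^ (3 * σ)) (𝓝[>] T)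
      (𝓝 (C * k ^ (-σ) / σ * 0 ^ (3 * σ))) :=
    (ha.rpow_const (Or.inr (by positivity))).const_mul _
  obtain ⟨l, hl⟩ := exists_tendsto_nhdsGT_of_abs_deriv_le hTw
    (f := fun t => 3 * Γ * log (a t) + log (ρ t))
    (fun t ht => ((((hda t ht).log (hsol t ht).1.ne').const_mul (3 * Γ)).fun_add
      ((hsol t ht).2.2.2.2.log (hsol t ht).2.1.ne')))
    (fun t ht => ((hda t ht).rpow_const (p := 3 * σ)
      (Or.inl (hsol t ht).1.ne')).const_mul (C * k ^ (-σ) / σ))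
    (fun t ht => by
      have hat := (hsol t ht).1
      have hρt := (hsol t ht).2.1
      have ha't := hpos t ⟨ht.1, (ht.2.trans_le (min_le_right _ _)).trans hp.2⟩
      have hb : |(Γ - 1) - P (ρ t) / c ^ 2 / ρ t| ≤ C * ρ t ^ (-σ) :=
        hPv ⟨ht.1, ht.2.trans_le (min_le_left _ _)⟩
      have hρσ : ρ t ^ (-σ) ≤ k ^ (-σ) * a t ^ (3 * σ) := by
        have h1 : ρ t ^ (-σ) ≤ (k / a t ^ 3) ^ (-σ) :=
          rpow_le_rpow_of_nonpos (by positivity)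
            (hkle t ⟨ht.1, ht.2.trans_le (min_le_right _ _)⟩) (by linarith)
        refine h1.trans_eq ?_
        rw [div_rpow hkpos.le (by positivity), ← rpow_natCast, ← rpow_mul hat.le,
          div_eq_mul_inv, ← rpow_neg hat.le]
        congr 2
        push_cast
        ring
      have heq : 3 * Γ * (deriv a t / a t) +
          -3 * (ρ t + P (ρ t) / c ^ 2) * (deriv a t / a t) / ρ t =
          3 * (deriv a t / a t) * ((Γ - 1) - P (ρ t) / c ^ 2 / ρ t) := by
        generalize P (ρ t) / c ^ 2 = q
        field_simp
        ring
      rw [heq, abs_mul, abs_of_pos (by positivity)]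
      calc 3 * (deriv a t / a t) * |(Γ - 1) - P (ρ t) / c ^ 2 / ρ t|
          ≤ 3 * (deriv a t / a t) * (C * (k ^ (-σ) * a t ^ (3 * σ))) := by
            gcongr
            exact hb.trans (by gcongr)
        _ = _ := by
          rw [rpow_sub_one hat.ne']
          field_simp)
    ha3σ
  refine ⟨exp l, exp_pos l, ((continuous_exp.tendsto l).comp hl).congr' ?_⟩
  filter_upwards [Ioo_mem_nhdsGT hTw] with t ht
  have hat := (hsol t ht).1
  have hρt := (hsol t ht).2.1
  rw [Function.comp, exp_add, exp_log hρt, rpow_def_of_pos hat, mul_comm (log (a t))]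

/-- The scale factor grows like a power of the time elapsed since it vanished. -/
theorem IsFriedmannSolution.tendsto_rpow_div {c G Λ : ℝ} {P a ρ : ℝ → ℝ} {T u Γ R : ℝ}
    (hΓ : 1 ≤ Γ) (hTu : T < u)
    (h : IsFriedmannSolution c G Λ P a ρ (Ioo T u)) (hpos : ∀ t ∈ Ioo T u, 0 < deriv a t)
    (ha : Tendsto a (𝓝[>] T) (𝓝 0))
    (hlim : Tendsto (fun t => a t ^ (3 * Γ) * ρ t) (𝓝[>] T) (𝓝 R)) :
    Tendsto (fun t => a t ^ (3 * Γ / 2) / (t - T)) (𝓝[>] T)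
      (𝓝 √(6 * π * Γ ^ 2 * G * R)) := by
  obtain ⟨k, hk⟩ := h.exists_sq_deriv_eq hTu
  have hrpow : ∀ q : ℝ, 0 < q → Tendsto (fun t => a t ^ q) (𝓝[>] T) (𝓝 0) := fun q hq => by
    simpa [zero_rpow hq.ne'] using ha.rpow_const (p := q) (Or.inr hq.le)
  have hd : Tendsto (fun t => √((3 * Γ / 2) ^ 2 * (8 * π * G / 3 * (a t ^ (3 * Γ) * ρ t) +
      c ^ 2 * Λ / 3 * a t ^ (3 * Γ) - k * a t ^ (3 * Γ - 2)))) (𝓝[>] T)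
      (𝓝 √(6 * π * Γ ^ 2 * G * R)) := by
    have h1 := (((hlim.const_mul (8 * π * G / 3)).add
      ((hrpow (3 * Γ) (by linarith)).const_mul (c ^ 2 * Λ / 3))).sub
      ((hrpow (3 * Γ - 2) (by linarith)).const_mul k)).const_mul ((3 * Γ / 2) ^ 2)
    have e : (3 * Γ / 2) ^ 2 * (8 * π * G / 3 * R + c ^ 2 * Λ / 3 * 0 - k * 0) =
        6 * π * Γ ^ 2 * G * R := by ring
    rw [e] at h1
    exact h1.sqrt
  refine HasDerivAt.lhopital_zero_nhdsGT
    (f' := fun t => deriv a t * (3 * Γ / 2) * a t ^ (3 * Γ / 2 - 1)) (g' := fun _ => 1)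
    ?_ ?_ ?_ (hrpow _ (by linarith)) ?_ ?_
  · filter_upwards [Ioo_mem_nhdsGT hTu] with t ht
    exact (h t ht).2.2.1.hasDerivAt.rpow_const (Or.inl (h t ht).1.ne')
  · exact Eventually.of_forall fun t => (hasDerivAt_id' t).sub_const T
  · simp
  · have : Tendsto (fun t : ℝ => t - T) (𝓝[>] T) (𝓝 (T - T)) :=
      (continuous_id.sub continuous_const).continuousAt.mono_left nhdsWithin_le_nhds
    simpa using this
  · refine hd.congr' ?_
    filter_upwards [Ioo_mem_nhdsGT hTu] with t ht
    have hat := (h t ht).1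
    have ha't := hpos t ht
    rw [div_one, eq_comm, ← sqrt_sq (by positivity :
      0 ≤ deriv a t * (3 * Γ / 2) * a t ^ (3 * Γ / 2 - 1))]
    congr 1
    have e1 : (a t ^ (3 * Γ / 2 - 1)) ^ 2 = a t ^ (3 * Γ - 2) := by
      rw [← rpow_natCast, ← rpow_mul hat.le]
      congr 1
      push_cast
      ring
    have e2 : a t ^ (3 * Γ) = a t ^ (3 * Γ - 2) * a t ^ 2 := by
      rw [← rpow_natCast, ← rpow_add hat]
      congr 1
      push_cast
      ring
    rw [mul_pow, mul_pow, e1, hk t ht, e2]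
    ring

/-- Under (A0) and (A1), near the Big Bang time `t₋` one has
`ρ(t) (t - t₋)² → 1/(6πΓ²G)` and `a(t) (t - t₋)^{-2/(3Γ)} → (6πΓ²Gρ₁)^{1/(3Γ)}`,
where `ρ₁ = lim a(t)^{3Γ} ρ(t) > 0`. -/
theorem bigbang_asymptotics
    (c G Λ : ℝ) (hc : 0 < c) (hG : 0 < G) (hΛ : 0 < Λ)
    (P : ℝ → ℝ) (hA0 : A0 c P) (Γ σ : ℝ) (hA1 : A1 c P Γ σ)
    (a ρ : ℝ → ℝ) (tm tp : EReal)
    (hmax : IsMaximalSolution c G Λ P a ρ tm tp)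
    (a0 adot0 ρ0 : ℝ) (ha0 : a 0 = a0) (hadot0 : deriv a 0 = adot0) (hρ0 : ρ 0 = ρ0)
    (ha0pos : 0 < a0) (hρ0pos : 0 < ρ0) (hadot0pos : 0 < adot0)
    (hcond : c ^ 2 * Λ ≤ 4 * Real.pi * G * (ρ0 + 3 * P ρ0 / c ^ 2)) :
    ∃ T : ℝ, tm = (T : EReal) ∧
      ∃ ρ1 : ℝ, 0 < ρ1 ∧
        Filter.Tendsto (fun t => a t ^ (3 * Γ) * ρ t)
          (nhdsWithin T (Set.Ioi T)) (nhds ρ1) ∧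
        Filter.Tendsto (fun t => ρ t * (t - T) ^ 2)
          (nhdsWithin T (Set.Ioi T)) (nhds (1 / (6 * Real.pi * Γ ^ 2 * G))) ∧
        Filter.Tendsto (fun t => a t * (t - T) ^ (-(2 / (3 * Γ))))
          (nhdsWithin T (Set.Ioi T))
          (nhds ((6 * Real.pi * Γ ^ 2 * G * ρ1) ^ (1 / (3 * Γ)))) := by
  subst ha0 hadot0 hρ0
  obtain ⟨hΓ1, hΓ2, hσ, -, -⟩ := id hA1
  obtain ⟨hm0, h0p, hsol, -⟩ := id hmax
  have hbound : ((-(a 0 / deriv a 0) : ℝ) : EReal) ≤ tm := by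
    by_contra! hlt
    have hneg : -(a 0 / deriv a 0) < 0 := neg_neg_of_pos (by positivity)
    obtain ⟨s, hs1, hs2⟩ := EReal.lt_iff_exists_real_btwn.1 hlt
    have hs : s < -(a 0 / deriv a 0) := by exact_mod_cast hs2
    have hsol' : IsFriedmannSolution c G Λ P a ρ (Icc s 0) := hsol.mono fun t ht =>
      ⟨hs1.trans_le (by exact_mod_cast ht.1), lt_of_le_of_lt (by exact_mod_cast ht.2) h0p⟩
    have hle := hsol'.le_add_mul hG hA0 (by linarith) hcond hadot0pos
    have hapos := (hsol' s ⟨le_rfl, by linarith⟩).1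
    rw [← neg_div, lt_div_iff₀ hadot0pos] at hs
    linarith
  obtain ⟨T, rfl⟩ : ∃ T : ℝ, tm = T :=
    ⟨tm.toReal, (EReal.coe_toReal (ne_top_of_lt hm0)
      (ne_bot_of_gt ((EReal.bot_lt_coe _).trans_le hbound))).symm⟩
  have hT : T < 0 := by exact_mod_cast hm0
  have h : IsFriedmannSolution c G Λ P a ρ (Ioo T 0) := hsol.mono fun t ht =>
    ⟨by exact_mod_cast ht.1, lt_trans (by exact_mod_cast ht.2) h0p⟩
  have hpos : ∀ t ∈ Ioo T 0, 0 < deriv a t := fun t ht =>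
    IsFriedmannSolution.deriv_pos hG hA0 (hsol.mono fun s hs =>
      ⟨by exact_mod_cast ht.1.trans_le hs.1, lt_of_le_of_lt (by exact_mod_cast hs.2) h0p⟩)
      hcond hadot0pos t ⟨le_rfl, ht.2.le⟩
  have ha := hmax.tendsto_zero hc hG hA0 hcond hadot0pos
  obtain ⟨R, hR, hlim⟩ := h.exists_tendsto_rpow_mul hc hA0 hA1 hT hpos ha
  have hq := h.tendsto_rpow_div hΓ1 hT hpos ha hlim
  have hκ : 0 < 6 * π * Γ ^ 2 * G * R := by positivity
  refine ⟨T, rfl, R, hR, hlim, ?_, ?_⟩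
  · have h1 := hlim.div (hq.pow 2) (by positivity)
    rw [sq_sqrt hκ.le] at h1
    have h2 : R / (6 * π * Γ ^ 2 * G * R) = 1 / (6 * π * Γ ^ 2 * G) := by field_simp
    rw [h2] at h1
    refine h1.congr' ?_
    filter_upwards [Ioo_mem_nhdsGT hT] with t ht
    have hat := (h t ht).1
    have htT : 0 < t - T := by linarith [ht.1]
    have e : a t ^ (3 * Γ) = (a t ^ (3 * Γ / 2)) ^ 2 := by
      rw [← rpow_natCast, ← rpow_mul hat.le]
      congr 1
      push_cast
      ring
    have hat' : 0 < a t ^ (3 * Γ / 2) := rpow_pos_of_pos hat _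
    rw [Pi.div_apply, e]
    field_simp
  · have h1 := hq.rpow_const (p := 2 / (3 * Γ)) (Or.inr (by positivity))
    have h2 : √(6 * π * Γ ^ 2 * G * R) ^ (2 / (3 * Γ)) =
        (6 * π * Γ ^ 2 * G * R) ^ (1 / (3 * Γ)) := by
      rw [sqrt_eq_rpow, ← rpow_mul hκ.le]
      congr 1
      field_simp
    rw [h2] at h1
    refine h1.congr' ?_
    filter_upwards [Ioo_mem_nhdsGT hT] with t ht
    have hat := (h t ht).1
    have htT : 0 < t - T := by linarith [ht.1]
    rw [div_rpow (by positivity) htT.le, ← rpow_mul hat.le, div_eq_mul_inv, ← rpow_neg htT.le]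
    congr 1
    have : 3 * Γ / 2 * (2 / (3 * Γ)) = 1 := by field_simp
    rw [this, rpow_one]
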